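/- Under the condition c₂ = c₁², the cochain-twisted product on the sphere coordinates satisfies the third Podles sphere relation on the generators: x₋ • x₊ = x₋x₊ + 4c₁ x₃² + 4c₁² x₊x₋ exactly in R, and modulo the sphere ideal I one has (1 − c₁)·(x₋ • x₊) ≡ 1 − (1 − 2c₁)²·(x₃ • x₃) (mod I). -/

import Mathlib

open MvPolynomial

/-- The polynomial ring `R = ℂ[x₊, x₋, x₃]`, with `X 0 = x₊`, `X 1 = x₋`, `X 2 = x₃`. -/
noncomputable abbrev Rsph : Type := MvPolynomial (Fin 3) ℂ

/-- The derivation `X` of `R` with `X x₊ = 0`, `X x₋ = −2i x₃`, `X x₃ = i x₊`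
(the action of the sl₂ element `x` by rotational vector fields). -/
noncomputable def Xder : Derivation ℂ Rsph Rsph :=
  MvPolynomial.mkDerivation ℂ
    ![0, C (-2 * Complex.I) * X 2, C Complex.I * X 0]

/-- The derivation `Y` of `R` with `Y x₊ = 2i x₃`, `Y x₋ = 0`, `Y x₃ = −i x₋`
(the action of the sl₂ element `y` by rotational vector fields). -/
noncomputable def Yder : Derivation ℂ Rsph Rsph :=
  MvPolynomial.mkDerivation ℂ
    ![C (2 * Complex.I) * X 2, 0, C (-Complex.I) * X 1]

/-- The cochain-twisted product `a • b = ab + c₁ (Xa)(Yb) + c₂ (X²a)(Y²b)`. -/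
noncomputable def twProd (c₁ c₂ : ℂ) (a b : Rsph) : Rsph :=
  a * b + C c₁ * (Xder a * Yder b) + C c₂ * (Xder (Xder a) * Yder (Yder b))

/-- The ideal of the unit 2-sphere, generated by `x₊x₋ + x₃² − 1`. -/
noncomputable def sphereIdeal : Ideal Rsph :=
  Ideal.span {X 0 * X 1 + X 2 ^ 2 - 1}

theorem C_I_mul_self : (C Complex.I * C Complex.I : Rsph) = -1 := by
  rw [← C_mul, Complex.I_mul_I, C_neg, C_1]

theorem Xder_X_zero : Xder (X 0) = 0 := by
  simp [Xder, mkDerivation_X]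

theorem Xder_X_one : Xder (X 1) = C (-2 * Complex.I) * X 2 := by
  simp [Xder, mkDerivation_X]

theorem Xder_X_two : Xder (X 2) = C Complex.I * X 0 := by
  simp [Xder, mkDerivation_X]

theorem Yder_X_zero : Yder (X 0) = C (2 * Complex.I) * X 2 := by
  simp [Yder, mkDerivation_X]

theorem Yder_X_one : Yder (X 1) = 0 := by
  simp [Yder, mkDerivation_X]

theorem Yder_X_two : Yder (X 2) = C (-Complex.I) * X 1 := by
  simp [Yder, mkDerivation_X]

theorem derivation_C_mul (D : Derivation ℂ Rsph Rsph) (a : ℂ) (p : Rsph) :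
    D (C a * p) = C a * D p := by
  rw [C_mul', D.map_smul, C_mul']

theorem twProd_X_one_X_zero (c₁ c₂ : ℂ) :
    twProd c₁ c₂ (X 1) (X 0)
      = X 1 * X 0 + C (4 * c₁) * X 2 ^ 2 + C (4 * c₂) * (X 0 * X 1) := by
  have hI := C_I_mul_self
  simp only [twProd, Xder_X_one, Xder_X_two, Yder_X_zero, Yder_X_two, derivation_C_mul]
  simp only [C_mul, C_neg, map_ofNat]
  linear_combination (-4 * C c₁ * X 2 ^ 2
    + 4 * C c₂ * X 0 * X 1 * (C Complex.I * C Complex.I - 1)) * hI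

theorem twProd_X_two_X_two (c₁ c₂ : ℂ) :
    twProd c₁ c₂ (X 2) (X 2) = X 2 ^ 2 + C c₁ * (X 0 * X 1) := by
  have hI := C_I_mul_self
  simp only [twProd, Xder_X_two, Xder_X_zero, Yder_X_two, Yder_X_one, derivation_C_mul]
  simp only [C_neg]
  linear_combination (-C c₁ * X 0 * X 1) * hI

/-- under `c₂ = c₁²`, the third Podles sphere relation holds on the
generators: `x₋ • x₊ = x₋x₊ + 4c₁ x₃² + 4c₁² x₊x₋` exactly in `R`, and modulo the
sphere ideal `I`, `(1 − c₁)·(x₋ • x₊) ≡ 1 − (1 − 2c₁)²·(x₃ • x₃)`. -/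
theorem podles_third_relation (c₁ : ℂ) :
    twProd c₁ (c₁ ^ 2) (X 1) (X 0)
      = X 1 * X 0 + C (4 * c₁) * X 2 ^ 2 + C (4 * c₁ ^ 2) * (X 0 * X 1) ∧
    C (1 - c₁) * twProd c₁ (c₁ ^ 2) (X 1) (X 0)
      - (1 - C ((1 - 2 * c₁) ^ 2) * twProd c₁ (c₁ ^ 2) (X 2) (X 2))
      ∈ sphereIdeal := by
  refine ⟨twProd_X_one_X_zero c₁ (c₁ ^ 2), ?_⟩
  rw [twProd_X_one_X_zero, twProd_X_two_X_two]
  refine Ideal.subset_span (Set.mem_singleton_iff.mpr ?_)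
  simp only [C_mul, C_sub, C_pow, C_1, map_ofNat]
  ring
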